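/- arXiv:1510.05393 — 2 statements merged into one kernel-verified Lean document; each statement's English description precedes it below -/
import Mathlib

section
/- Let X be a complete metric space and m : X × X → X a conical midpoint assignment, i.e., d(x, m(x,y)) = d(m(x,y), y) = d(x,y)/2 for all x,y ∈ X, and d(m(x,y), m(x',y')) ≤ (1/2)·d(x,x') + (1/2)·d(y,y') for all x,y,x',y' ∈ X. Then X admits a conical geodesic bicombing σ with σ(x,y,1/2) = m(x,y) for all x,y ∈ X. -/
/-- A conical geodesic bicombing on a metric space `X`. -/
def IsConicalBicombing {X : Type*} [MetricSpace X] (σ : X → X → ℝ → X) : Prop :=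
  (∀ x y : X, σ x y 0 = x) ∧
  (∀ x y : X, σ x y 1 = y) ∧
  (∀ x y : X, ∀ t ∈ Set.Icc (0:ℝ) 1, ∀ t' ∈ Set.Icc (0:ℝ) 1,
      dist (σ x y t) (σ x y t') = |t - t'| * dist x y) ∧
  (∀ x y x' y' : X, ∀ t ∈ Set.Icc (0:ℝ) 1,
      dist (σ x y t) (σ x' y' t) ≤ (1 - t) * dist x x' + t * dist y y')

/-- A conical midpoint assignment on a metric space `X`. -/
def IsConicalMidpoint {X : Type*} [MetricSpace X] (m : X → X → X) : Prop :=
  (∀ x y : X, dist x (m x y) = dist x y / 2) ∧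
  (∀ x y : X, dist (m x y) y = dist x y / 2) ∧
  (∀ x y x' y' : X, dist (m x y) (m x' y') ≤ (1 / 2) * dist x x' + (1 / 2) * dist y y')

/-- The `n`-th dyadic approximation, by iterated midpoints, of the geodesics defined by `m`. -/
noncomputable def dyadicPath {X : Type*} (m : X → X → X) : ℕ → X → X → ℝ → X
  | 0, x, _, _ => x
  | n + 1, x, y, t =>
    if t ≤ 1 / 2 then dyadicPath m n x (m x y) (2 * t) else dyadicPath m n (m x y) y (2 * t - 1)

section dyadicPath

open Filter Topology

variable {X : Type*} {m : X → X → X}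

lemma dyadicPath_succ_of_le (n : ℕ) (x y : X) {t : ℝ} (ht : t ≤ 1 / 2) :
    dyadicPath m (n + 1) x y t = dyadicPath m n x (m x y) (2 * t) := by
  rw [dyadicPath, if_pos ht]

lemma dyadicPath_succ_of_lt (n : ℕ) (x y : X) {t : ℝ} (ht : 1 / 2 < t) :
    dyadicPath m (n + 1) x y t = dyadicPath m n (m x y) y (2 * t - 1) := by
  rw [dyadicPath, if_neg ht.not_ge]

variable [MetricSpace X]

lemma dist_dyadicPath_succ_le (hm : IsConicalMidpoint m) (n : ℕ) (x y : X) (t : ℝ) :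
    dist (dyadicPath m n x y t) (dyadicPath m (n + 1) x y t) ≤ dist x y * (1 / 2) ^ n := by
  obtain ⟨hl, hr, -⟩ := hm
  induction n generalizing x y t with
  | zero =>
    have := hl x y
    have := dist_nonneg (x := x) (y := y)
    rcases le_or_gt t (1 / 2) with ht | ht
    · rw [dyadicPath_succ_of_le 0 x y ht]
      simp [dyadicPath]
    · rw [dyadicPath_succ_of_lt 0 x y ht]
      simp only [dyadicPath, pow_zero]
      linarith
  | succ n ih =>
    rcases le_or_gt t (1 / 2) with ht | ht
    · rw [dyadicPath_succ_of_le _ x y ht, dyadicPath_succ_of_le _ x y ht]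
      refine (ih _ _ _).trans_eq ?_
      rw [hl]; ring
    · rw [dyadicPath_succ_of_lt _ x y ht, dyadicPath_succ_of_lt _ x y ht]
      refine (ih _ _ _).trans_eq ?_
      rw [hr]; ring

lemma dist_left_dyadicPath_le (hm : IsConicalMidpoint m) (n : ℕ) (x y : X) {t : ℝ}
    (ht : 0 ≤ t) : dist x (dyadicPath m n x y t) ≤ t * dist x y := by
  obtain ⟨hl, hr, -⟩ := hm
  induction n generalizing x y t with
  | zero => simpa [dyadicPath] using by positivity
  | succ n ih =>
    rcases le_or_gt t (1 / 2) with h | h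
    · rw [dyadicPath_succ_of_le _ x y h]
      have := ih x (m x y) (t := 2 * t) (by linarith)
      rw [hl] at this
      linarith
    · rw [dyadicPath_succ_of_lt _ x y h]
      have h₁ := ih (m x y) y (t := 2 * t - 1) (by linarith)
      have h₂ := dist_triangle x (m x y) (dyadicPath m n (m x y) y (2 * t - 1))
      rw [hr] at h₁
      rw [hl] at h₂
      linarith

lemma dist_dyadicPath_right_le (hm : IsConicalMidpoint m) (n : ℕ) (x y : X) {t : ℝ}
    (ht : t ≤ 1) :
    dist (dyadicPath m n x y t) y ≤ (1 - t) * dist x y + dist x y * (1 / 2) ^ n := by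
  obtain ⟨hl, hr, -⟩ := hm
  induction n generalizing x y t with
  | zero =>
    have : 0 ≤ (1 - t) * dist x y := mul_nonneg (by linarith) dist_nonneg
    simpa [dyadicPath] using this
  | succ n ih =>
    rcases le_or_gt t (1 / 2) with h | h
    · rw [dyadicPath_succ_of_le _ x y h]
      have h₁ := ih x (m x y) (t := 2 * t) (by linarith)
      have h₂ := dist_triangle (dyadicPath m n x (m x y) (2 * t)) (m x y) y
      rw [hl] at h₁
      rw [hr] at h₂
      rw [pow_succ]
      linarith
    · rw [dyadicPath_succ_of_lt _ x y h]
      have := ih (m x y) y (t := 2 * t - 1) (by linarith)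
      rw [hr] at this
      rw [pow_succ]
      linarith

lemma dist_dyadicPath_dyadicPath_le (hm : IsConicalMidpoint m) (n : ℕ) (x y : X) {s t : ℝ}
    (hs : 0 ≤ s) (hst : s ≤ t) (ht : t ≤ 1) :
    dist (dyadicPath m n x y s) (dyadicPath m n x y t) ≤
      (t - s) * dist x y + dist x y * (1 / 2) ^ n := by
  have hl := hm.1
  have hr := hm.2.1
  induction n generalizing x y s t with
  | zero =>
    have : 0 ≤ (t - s) * dist x y := mul_nonneg (by linarith) dist_nonneg
    simp only [dyadicPath, dist_self, pow_zero, mul_one]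
    positivity
  | succ n ih =>
    rw [pow_succ]
    rcases le_or_gt t (1 / 2) with h | h
    · rw [dyadicPath_succ_of_le _ x y h, dyadicPath_succ_of_le _ x y (hst.trans h)]
      have := ih x (m x y) (s := 2 * s) (t := 2 * t) (by linarith) (by linarith) (by linarith)
      rw [hl] at this
      linarith
    rcases le_or_gt s (1 / 2) with h' | h'
    · rw [dyadicPath_succ_of_lt _ x y h, dyadicPath_succ_of_le _ x y h']
      have h₁ := dist_dyadicPath_right_le hm n x (m x y) (t := 2 * s) (by linarith)
      have h₂ := dist_left_dyadicPath_le hm n (m x y) y (t := 2 * t - 1) (by linarith)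
      have h₃ := dist_triangle (dyadicPath m n x (m x y) (2 * s)) (m x y)
        (dyadicPath m n (m x y) y (2 * t - 1))
      rw [hl] at h₁
      rw [hr] at h₂
      linarith
    · rw [dyadicPath_succ_of_lt _ x y h, dyadicPath_succ_of_lt _ x y h']
      have := ih (m x y) y (s := 2 * s - 1) (t := 2 * t - 1) (by linarith) (by linarith)
        (by linarith)
      rw [hr] at this
      linarith

lemma dist_dyadicPath_le_add (hm : IsConicalMidpoint m) (n : ℕ) (x y x' y' : X) {t : ℝ}
    (ht₀ : 0 ≤ t) (ht₁ : t ≤ 1) :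
    dist (dyadicPath m n x y t) (dyadicPath m n x' y' t) ≤
      (1 - t) * dist x x' + t * dist y y' + (dist x y + dist x' y') * (1 / 2) ^ n := by
  obtain ⟨hl, hr, hc⟩ := hm
  induction n generalizing x y x' y' t with
  | zero =>
    have h₁ := dist_triangle4 x y y' x'
    rw [dist_comm y' x'] at h₁
    have h₂ := mul_le_mul_of_nonneg_left h₁ ht₀
    have h₃ : t * (dist x y + dist x' y') ≤ 1 * (dist x y + dist x' y') := by gcongr
    simp only [dyadicPath, pow_zero]
    linarith
  | succ n ih =>
    rw [pow_succ]
    rcases le_or_gt t (1 / 2) with h | h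
    · rw [dyadicPath_succ_of_le _ x y h, dyadicPath_succ_of_le _ x' y' h]
      have h₁ := ih x (m x y) x' (m x' y') (t := 2 * t) (by linarith) (by linarith)
      have h₂ := mul_le_mul_of_nonneg_left (hc x y x' y') (show 0 ≤ 2 * t by linarith)
      rw [hl, hl] at h₁
      linarith
    · rw [dyadicPath_succ_of_lt _ x y h, dyadicPath_succ_of_lt _ x' y' h]
      have h₁ := ih (m x y) y (m x' y') y' (t := 2 * t - 1) (by linarith) (by linarith)
      have h₂ := mul_le_mul_of_nonneg_left (hc x y x' y')
        (show 0 ≤ 1 - (2 * t - 1) by linarith)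
      rw [hr, hr] at h₁
      linarith

lemma exists_tendsto_dyadicPath [CompleteSpace X] (hm : IsConicalMidpoint m) (x y : X) (t : ℝ) :
    ∃ z, Tendsto (fun n => dyadicPath m n x y t) atTop (𝓝 z) :=
  cauchySeq_tendsto_of_complete
    (cauchySeq_of_le_geometric _ _ one_half_lt_one (dist_dyadicPath_succ_le hm · x y t))

lemma tendsto_add_mul_one_half_pow (a b : ℝ) :
    Tendsto (fun n : ℕ => a + b * (1 / 2) ^ n) atTop (𝓝 a) := by
  simpa using ((tendsto_pow_atTop_nhds_zero_of_lt_one (r := (1 / 2 : ℝ)) (by norm_num)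
    (by norm_num)).const_mul b).const_add a

end dyadicPath

/-- On a complete metric space, a conical midpoint assignment extends to a conical
geodesic bicombing whose midpoints are the given ones. -/
theorem stmt3 {X : Type*} [MetricSpace X] [CompleteSpace X]
    (m : X → X → X) (hm : IsConicalMidpoint m) :
    ∃ σ : X → X → ℝ → X, IsConicalBicombing σ ∧
      ∀ x y : X, σ x y (1 / 2) = m x y := by
  choose σ hσ using exists_tendsto_dyadicPath hm
  have left_le (x y : X) {t : ℝ} (ht : 0 ≤ t) : dist x (σ x y t) ≤ t * dist x y :=
    le_of_tendsto' (tendsto_const_nhds.dist (hσ x y t))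
      fun n => dist_left_dyadicPath_le hm n x y ht
  have right_le (x y : X) {t : ℝ} (ht : t ≤ 1) : dist (σ x y t) y ≤ (1 - t) * dist x y :=
    le_of_tendsto_of_tendsto' ((hσ x y t).dist tendsto_const_nhds)
      (tendsto_add_mul_one_half_pow _ _) fun n => dist_dyadicPath_right_le hm n x y ht
  have dist_le (x y : X) {s t : ℝ} (hs : 0 ≤ s) (hst : s ≤ t) (ht : t ≤ 1) :
      dist (σ x y s) (σ x y t) ≤ (t - s) * dist x y :=
    le_of_tendsto_of_tendsto' ((hσ x y s).dist (hσ x y t))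
      (tendsto_add_mul_one_half_pow _ _)
      fun n => dist_dyadicPath_dyadicPath_le hm n x y hs hst ht
  have dist_eq (x y : X) {s t : ℝ} (hs : 0 ≤ s) (hst : s ≤ t) (ht : t ≤ 1) :
      dist (σ x y s) (σ x y t) = (t - s) * dist x y := by
    refine le_antisymm (dist_le x y hs hst ht) ?_
    have := dist_triangle4 x (σ x y s) (σ x y t) y
    linarith [left_le x y hs, right_le x y ht]
  have apply_one (x y : X) : σ x y 1 = y :=
    dist_le_zero.1 (by simpa using right_le x y le_rfl)
  refine ⟨σ, ⟨fun x y => ?_, apply_one, fun x y t ht t' ht' => ?_,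
    fun x y x' y' t ht => ?_⟩, fun x y => ?_⟩
  · exact (dist_le_zero.1 (by simpa using left_le x y le_rfl)).symm
  · rcases le_total t t' with h | h
    · rw [dist_eq x y ht.1 h ht'.2, abs_sub_comm, abs_of_nonneg (sub_nonneg.2 h)]
    · rw [dist_comm, dist_eq x y ht'.1 h ht.2, abs_of_nonneg (sub_nonneg.2 h)]
  · exact le_of_tendsto_of_tendsto' ((hσ x y t).dist (hσ x' y' t))
      (tendsto_add_mul_one_half_pow _ _)
      fun n => dist_dyadicPath_le_add hm n x y x' y' ht.1 ht.2
  · refine (tendsto_nhds_unique ((Filter.tendsto_add_atTop_iff_nat 1).2 (hσ x y (1 / 2))) ?_).trans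
      (apply_one x (m x y))
    simpa [dyadicPath_succ_of_le] using hσ x (m x y) 1
end

section
/- Let X be a metric space with a conical geodesic bicombing σ, and let C ⊆ X be any subset. Then the diameter of the closed σ-convex hull of C equals the diameter of C (as elements of [0,∞]). -/
/-- A set `C` is `σ`-convex. -/
def SigmaConvex {X : Type*} [MetricSpace X] (σ : X → X → ℝ → X) (C : Set X) : Prop :=
  ∀ x ∈ C, ∀ y ∈ C, ∀ t ∈ Set.Icc (0:ℝ) 1, σ x y t ∈ C

/-- The closed `σ`-convex hull of `C`. -/
def closedSigmaConvexHull {X : Type*} [MetricSpace X] (σ : X → X → ℝ → X) (C : Set X) :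
    Set X :=
  ⋂₀ {D : Set X | C ⊆ D ∧ IsClosed D ∧ SigmaConvex σ D}

theorem IsConicalBicombing.apply_self {X : Type*} [MetricSpace X] {σ : X → X → ℝ → X}
    (hσ : IsConicalBicombing σ) (x : X) {t : ℝ} (ht : t ∈ Set.Icc (0 : ℝ) 1) :
    σ x x t = x := by
  obtain ⟨h0, -, hd, -⟩ := hσ
  have h := hd x x t ht 0 ⟨le_rfl, zero_le_one⟩
  rwa [h0, dist_self, mul_zero, dist_eq_zero] at h

theorem IsConicalBicombing.sigmaConvex_closedBall {X : Type*} [MetricSpace X]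
    {σ : X → X → ℝ → X} (hσ : IsConicalBicombing σ) (x : X) (r : ℝ) :
    SigmaConvex σ (Metric.closedBall x r) := by
  intro y hy z hz t ht
  rw [Metric.mem_closedBall] at *
  have h := hσ.2.2.2 y z x x t ht
  rw [hσ.apply_self x ht] at h
  nlinarith [ht.1, ht.2]

theorem subset_closedSigmaConvexHull {X : Type*} [MetricSpace X] (σ : X → X → ℝ → X)
    (C : Set X) : C ⊆ closedSigmaConvexHull σ C :=
  Set.subset_sInter fun _ hD => hD.1

theorem closedSigmaConvexHull_subset_closedBall {X : Type*} [MetricSpace X]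
    {σ : X → X → ℝ → X} (hσ : IsConicalBicombing σ) {C : Set X} {x : X} {r : ℝ}
    (h : C ⊆ Metric.closedBall x r) :
    closedSigmaConvexHull σ C ⊆ Metric.closedBall x r :=
  Set.sInter_subset_of_mem ⟨h, Metric.isClosed_closedBall, hσ.sigmaConvex_closedBall x r⟩

theorem dist_le_of_mem_closedSigmaConvexHull {X : Type*} [MetricSpace X]
    {σ : X → X → ℝ → X} (hσ : IsConicalBicombing σ) {C : Set X} {r : ℝ}
    (h : ∀ x ∈ C, ∀ y ∈ C, dist x y ≤ r) {x y : X}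
    (hx : x ∈ closedSigmaConvexHull σ C) (hy : y ∈ closedSigmaConvexHull σ C) :
    dist x y ≤ r := by
  refine closedSigmaConvexHull_subset_closedBall hσ (fun c hc => ?_) hx
  rw [Metric.mem_closedBall']
  exact closedSigmaConvexHull_subset_closedBall hσ (fun c' hc' => h c' hc' c hc) hy

/-- The diameter (in `[0, ∞]`) of the closed `σ`-convex hull of a set `C` equals the
diameter of `C`. -/
theorem stmt18 {X : Type*} [MetricSpace X]
    (σ : X → X → ℝ → X) (hσ : IsConicalBicombing σ) (C : Set X) :
    EMetric.diam (closedSigmaConvexHull σ C) = EMetric.diam C := by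
  refine le_antisymm ?_ (Metric.ediam_mono (subset_closedSigmaConvexHull σ C))
  by_cases hC : Metric.ediam C = ⊤
  · exact le_top.trans_eq hC.symm
  · refine Metric.ediam_le fun x hx y hy => ?_
    rw [edist_dist]
    exact ENNReal.ofReal_le_of_le_toReal <| dist_le_of_mem_closedSigmaConvexHull hσ
      (fun a ha b hb => Metric.dist_le_diam_of_mem' hC ha hb) hx hy
end
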